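/- arXiv:dg-ga/9704015 — 4 statements merged into one kernel-verified Lean document; each statement's English description precedes it below -/
import Mathlib

section
/- Let n ≥ 4 and 2 ≤ p ≤ n−2. Set D = (1/2)·p(n−p) + (4/3)·binom(p,2)·binom(n−p,2) and C(n,p) = D/(1+D). Let R be an algebraic curvature tensor on ℝⁿ, and suppose there exists A > 0 such that for every orthonormal basis (v¹,…,vⁿ) of ℝⁿ one has C(n,p)·A < Σ_{i=1}^p Σ_{j=p+1}^n K(vⁱ,vʲ) < A. Then the Weitzenböck curvature operator R^p is positive definite: ⟨R^p ω, ω⟩ > 0 for every nonzero ω ∈ ⋀^p ℝⁿ. -/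
open scoped BigOperators RealInnerProductSpace

noncomputable section

/-- An algebraic curvature tensor on a real module: a quadrilinear form with the
symmetries of the Riemann curvature tensor. -/
structure AlgCurv (V : Type*) [AddCommGroup V] [Module ℝ V] where
  T : V →ₗ[ℝ] V →ₗ[ℝ] V →ₗ[ℝ] V →ₗ[ℝ] ℝ
  antisym₁ : ∀ x y z w, T x y z w = - T y x z w
  antisym₂ : ∀ x y z w, T x y z w = - T x y w z
  pairsym : ∀ x y z w, T x y z w = T z w x y
  bianchi : ∀ x y z w, T x y z w + T y z x w + T z x y w = 0

/-- Coordinates of the exterior algebra of ℝⁿ in the orthonormal basis `e^S`,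
`S` ranging over subsets of `{1,…,n}`. -/
abbrev ExtCoord (n : ℕ) := Finset (Fin n) → ℝ

/-- The sign `(-1)^{#{m ∈ S : m < i}}`. -/
def sgn {n : ℕ} (i : Fin n) (S : Finset (Fin n)) : ℝ :=
  (-1 : ℝ) ^ (S.filter fun m => m < i).card

/-- Exterior multiplication `(aⁱ)*` by `e_i`, in coordinates. -/
def wedgeE {n : ℕ} (i : Fin n) (f : ExtCoord n) : ExtCoord n :=
  fun S => if i ∈ S then sgn i S * f (S.erase i) else 0

/-- Interior multiplication `aⁱ` by `e_i`, in coordinates. -/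
def contrE {n : ℕ} (i : Fin n) (f : ExtCoord n) : ExtCoord n :=
  fun S => if i ∈ S then 0 else sgn i S * f (insert i S)

/-- Weitzenböck operator built from curvature components via Witten's formula
`R^p = Σ_{i,j,k,l} R_{ijkl} (aⁱ)* aʲ (aᵏ)* aˡ`. -/
def weitzOp {n : ℕ} (c : Fin n → Fin n → Fin n → Fin n → ℝ) (f : ExtCoord n) : ExtCoord n :=
  ∑ i, ∑ j, ∑ k, ∑ l, c i j k l • wedgeE i (contrE j (wedgeE k (contrE l f)))

/-- The standard orthonormal basis vector `e_i` of ℝⁿ. -/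
def estd {n : ℕ} (i : Fin n) : EuclideanSpace ℝ (Fin n) := EuclideanSpace.single i 1

/-- The Weitzenböck curvature operator of an algebraic curvature tensor on ℝⁿ. -/
def weitz {n : ℕ} (R : AlgCurv (EuclideanSpace ℝ (Fin n))) (f : ExtCoord n) : ExtCoord n :=
  weitzOp (fun i j k l => R.T (estd i) (estd j) (estd k) (estd l)) f

/-- The inner product on the exterior algebra making the `e^S` orthonormal. -/
def extInner {n : ℕ} (f g : ExtCoord n) : ℝ := ∑ S : Finset (Fin n), f S * g S

/-- The basis element `e^S` of the exterior algebra. -/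
def eB {n : ℕ} (S : Finset (Fin n)) : ExtCoord n := fun T => if T = S then 1 else 0

/-- Sectional curvature `K(u,v) = -R(u,v,u,v)` (paper's sign convention). -/
def sectK {V : Type*} [AddCommGroup V] [Module ℝ V] (R : AlgCurv V) (u v : V) : ℝ :=
  - R.T u v u v

/-- Wedging with a vector `x ∈ ℝⁿ`, in coordinates. -/
def wedgeV {n : ℕ} (x : EuclideanSpace ℝ (Fin n)) (f : ExtCoord n) : ExtCoord n :=
  ∑ i, x i • wedgeE i f

/-- The wedge product `u¹ ∧ … ∧ u^p` of a family of vectors. -/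
def wedgeFam {n p : ℕ} (u : Fin p → EuclideanSpace ℝ (Fin n)) : ExtCoord n :=
  (List.ofFn u).foldr wedgeV (eB ∅)

/-- The sum of sectional curvatures `Σ_{i=1}^p Σ_{j=p+1}^n K(vⁱ,vʲ)`. -/
def sumK {n : ℕ} (R : AlgCurv (EuclideanSpace ℝ (Fin n))) (p : ℕ)
    (v : Fin n → EuclideanSpace ℝ (Fin n)) : ℝ :=
  ∑ i ∈ Finset.univ.filter (fun i : Fin n => (i : ℕ) < p),
    ∑ j ∈ Finset.univ.filter (fun j : Fin n => p ≤ (j : ℕ)), sectK R (v i) (v j)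

/-- The constant `D = (1/2)p(n−p) + (4/3)·binom(p,2)·binom(n−p,2)`. -/
def Dconst (n p : ℕ) : ℝ :=
  (1 : ℝ) / 2 * ((p * (n - p) : ℕ) : ℝ)
    + (4 : ℝ) / 3 * ((p.choose 2 * ((n - p).choose 2) : ℕ) : ℝ)

/-- The pinching constant `C(n,p) = D/(1+D)`. -/
def Cnp (n p : ℕ) : ℝ := Dconst n p / (1 + Dconst n p)

/-- The set obtained from `I` by removing `i` and inserting `j`. -/
def hop {n : ℕ} (i j : Fin n) (I : Finset (Fin n)) : Finset (Fin n) := insert j (I.erase i)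

/-- The coefficient picked up by `(aⁱ)* aʲ` on the coordinate `I`. -/
def hopSign {n : ℕ} (i j : Fin n) (I : Finset (Fin n)) : ℝ :=
  if i ∈ I ∧ j ∉ I.erase i then sgn i (I.erase i) * sgn j (I.erase i) else 0

/-- The matrix entries of `weitzOp c` in the basis `e^S`. -/
def weitzEntry {n : ℕ} (c : Fin n → Fin n → Fin n → Fin n → ℝ) (I J : Finset (Fin n)) : ℝ :=
  ∑ i, ∑ j, ∑ k, ∑ l,
    if hop k l (hop i j I) = J then c i j k l * (hopSign i j I * hopSign k l (hop i j I)) else 0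

theorem sgn_erase_self {n : ℕ} (i : Fin n) (S : Finset (Fin n)) : sgn i (S.erase i) = sgn i S := by
  unfold sgn
  congr 2
  ext m
  simp only [Finset.mem_filter, Finset.mem_erase]
  grind

theorem wedgeE_contrE_apply {n : ℕ} (i j : Fin n) (f : ExtCoord n) (I : Finset (Fin n)) :
    wedgeE i (contrE j f) I = hopSign i j I * f (hop i j I) := by
  unfold wedgeE contrE hopSign hop
  rw [sgn_erase_self]
  split_ifs <;> first | ring1 | (exfalso; tauto)

theorem weitzOp_apply {n : ℕ} (c : Fin n → Fin n → Fin n → Fin n → ℝ) (f : ExtCoord n)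
    (I : Finset (Fin n)) : weitzOp c f I = ∑ J, weitzEntry c I J * f J := by
  simp only [weitzOp, weitzEntry, Finset.sum_apply, Pi.smul_apply, smul_eq_mul,
    wedgeE_contrE_apply, Finset.sum_mul]
  symm
  refine Finset.sum_comm.trans (Finset.sum_congr rfl fun i _ => ?_)
  refine Finset.sum_comm.trans (Finset.sum_congr rfl fun j _ => ?_)
  refine Finset.sum_comm.trans (Finset.sum_congr rfl fun k _ => ?_)
  refine Finset.sum_comm.trans (Finset.sum_congr rfl fun l _ => ?_)
  simp [ite_mul, mul_assoc]

/-- The sign exchanged between two fermionic indices. -/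
def crossSign {n : ℕ} (j i : Fin n) : ℝ := if j < i then -1 else 1

theorem sgn_insert {n : ℕ} (i j : Fin n) (S : Finset (Fin n)) (hj : j ∉ S) :
    sgn i (insert j S) = crossSign j i * sgn i S := by
  unfold sgn crossSign
  rw [Finset.filter_insert]
  split_ifs with h
  · rw [Finset.card_insert_of_notMem (by simp [hj]), pow_succ]
    ring
  · ring

theorem crossSign_swap {n : ℕ} {i j : Fin n} (h : i ≠ j) : crossSign i j = -crossSign j i := by
  unfold crossSign
  rcases lt_or_gt_of_ne h with h | h <;> simp [h, not_lt.2 h.le]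

theorem crossSign_mul_self {n : ℕ} (i j : Fin n) : crossSign i j * crossSign i j = 1 := by
  unfold crossSign
  split_ifs <;> norm_num

theorem sgn_mul_self {n : ℕ} (i : Fin n) (S : Finset (Fin n)) : sgn i S * sgn i S = 1 := by
  unfold sgn
  rw [← mul_pow]
  norm_num

theorem abs_sgn {n : ℕ} (i : Fin n) (S : Finset (Fin n)) : |sgn i S| = 1 := by
  simp [sgn, abs_pow]

theorem abs_crossSign {n : ℕ} (i j : Fin n) : |crossSign i j| = 1 := by
  unfold crossSign
  split_ifs <;> simp

theorem mem_hop {n : ℕ} {i j m : Fin n} {I : Finset (Fin n)} :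
    m ∈ hop i j I ↔ m = j ∨ (m ≠ i ∧ m ∈ I) := by
  simp [hop]

theorem hopSign_insert {n : ℕ} {i j : Fin n} {H : Finset (Fin n)} (hi : i ∉ H) (hj : j ∉ H) :
    hopSign i j (insert i H) = sgn i H * sgn j H := by
  simp [hopSign, Finset.erase_insert hi, hj]

theorem hop_insert {n : ℕ} {i j : Fin n} {H : Finset (Fin n)} (hi : i ∉ H) :
    hop i j (insert i H) = insert j H := by
  simp [hop, Finset.erase_insert hi]

theorem hopSign_mul_hopSign_hop_swap {n : ℕ} {i j : Fin n} {I : Finset (Fin n)} (hi : i ∈ I)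
    (hj : j ∉ I) : hopSign i j I * hopSign j i (hop i j I) = 1 := by
  obtain ⟨H, hiH, rfl⟩ : ∃ H, i ∉ H ∧ insert i H = I :=
    ⟨I.erase i, by simp, Finset.insert_erase hi⟩
  have hjH : j ∉ H := fun h => hj (Finset.mem_insert_of_mem h)
  rw [hopSign_insert hiH hjH, hop_insert hiH, hopSign_insert hjH hiH]
  linear_combination sgn_mul_self i H * (sgn j H * sgn j H) + sgn_mul_self j H

theorem hopSign_ne_zero {n : ℕ} {i j : Fin n} {I : Finset (Fin n)} (h : hopSign i j I ≠ 0) :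
    i ∈ I ∧ (j = i ∨ j ∉ I) := by
  unfold hopSign at h
  split_ifs at h with h'
  · exact ⟨h'.1, by simpa [Finset.mem_erase, or_iff_not_imp_left] using h'.2⟩
  · exact absurd rfl h

section
variable {n : ℕ} {c : Fin n → Fin n → Fin n → Fin n → ℝ}

theorem weitzEntry_term_ne_zero (h₁ : ∀ i k l, c i i k l = 0) (h₂ : ∀ i j k, c i j k k = 0)
    {I J : Finset (Fin n)} {i j k l : Fin n}
    (h : (if hop k l (hop i j I) = J then
      c i j k l * (hopSign i j I * hopSign k l (hop i j I)) else 0) ≠ 0) :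
    i ≠ j ∧ k ≠ l ∧ i ∈ I ∧ j ∉ I ∧ k ∈ hop i j I ∧ l ∉ hop i j I ∧ hop k l (hop i j I) = J := by
  split_ifs at h with hJ
  · have hij : i ≠ j := by rintro rfl; simp [h₁] at h
    have hkl : k ≠ l := by rintro rfl; simp [h₂] at h
    have a := hopSign_ne_zero (left_ne_zero_of_mul (right_ne_zero_of_mul h))
    have b := hopSign_ne_zero (right_ne_zero_of_mul (right_ne_zero_of_mul h))
    exact ⟨hij, hkl, a.1, a.2.resolve_left hij.symm, b.1, b.2.resolve_left hkl.symm, hJ⟩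
  · exact absurd rfl h

theorem weitzEntry_self (h₁ : ∀ i k l, c i i k l = 0) (h₂ : ∀ i j k, c i j k k = 0)
    (I : Finset (Fin n)) : weitzEntry c I I = ∑ i ∈ I, ∑ j ∈ Iᶜ, c i j j i := by
  have key : ∀ i j k l, (if hop k l (hop i j I) = I then
      c i j k l * (hopSign i j I * hopSign k l (hop i j I)) else 0) =
      if l = i then if k = j then if i ∈ I then if j ∈ Iᶜ then c i j j i else 0 else 0 else 0
        else 0 := by
    intro i j k l
    by_cases hc : k = j ∧ l = i ∧ i ∈ I ∧ j ∈ Iᶜ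
    · obtain ⟨rfl, rfl, hi, hj⟩ := hc
      have hj' : k ∉ I := by simpa using hj
      rw [if_pos, hopSign_mul_hopSign_hop_swap hi hj']
      · simp [hi, hj']
      · ext m
        simp only [mem_hop]
        grind
    · have : (if l = i then if k = j then if i ∈ I then if j ∈ Iᶜ then c i j j i else 0 else 0
          else 0 else 0) = 0 := by
        split_ifs <;> first | rfl | (exfalso; tauto)
      rw [this]
      by_contra hne
      obtain ⟨hij, hkl, hi, hj, hk, hl, hJ⟩ := weitzEntry_term_ne_zero h₁ h₂ hne
      have hm : ∀ m, m ∈ hop k l (hop i j I) ↔ m ∈ I := fun m => by rw [hJ]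
      simp only [mem_hop, Finset.mem_compl] at hm hk hl hc
      have := hm i
      have := hm j
      have := hm k
      have := hm l
      grind
  simp only [weitzEntry, key, Finset.sum_ite_eq', Finset.mem_univ, if_true,
    Finset.sum_ite_irrel, Finset.sum_const_zero, Finset.sum_ite_mem, Finset.univ_inter]

theorem weitzEntry_insert (h₁ : ∀ i k l, c i i k l = 0) (h₂ : ∀ i j k, c i j k k = 0)
    {H : Finset (Fin n)} {a b : Fin n} (ha : a ∉ H) (hb : b ∉ H) (hab : a ≠ b) :
    weitzEntry c (insert a H) (insert b H) = sgn a H * sgn b H *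
      (∑ x ∈ (insert a (insert b H))ᶜ, c a x x b - ∑ x ∈ H, c x b a x) := by
  have key : ∀ i j k l, (if hop k l (hop i j (insert a H)) = insert b H then
      c i j k l * (hopSign i j (insert a H) * hopSign k l (hop i j (insert a H))) else 0) =
      sgn a H * sgn b H *
      ((if l = b then if k = j then if i = a then
          if j ∈ (insert a (insert b H))ᶜ then c a j j b else 0 else 0 else 0 else 0) -
       (if l = i then if k = a then if j = b then
          if i ∈ H then c i b a i else 0 else 0 else 0 else 0)) := by
    intro i j k l
    by_cases hc : i = a ∧ l = b ∧ k = j ∧ j ∈ (insert a (insert b H))ᶜ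
    · obtain ⟨rfl, rfl, rfl, hj⟩ := hc
      simp only [Finset.mem_compl, Finset.mem_insert, not_or] at hj
      rw [hop_insert ha, hop_insert hj.2.2, if_pos rfl, hopSign_insert ha hj.2.2,
        hopSign_insert hj.2.2 hb]
      simp [hj]
      linear_combination c i k k l * sgn i H * sgn l H * sgn_mul_self k H
    by_cases hc' : j = b ∧ k = a ∧ l = i ∧ i ∈ H
    · obtain ⟨rfl, rfl, rfl, hl⟩ := hc'
      obtain ⟨G, hlG, rfl⟩ : ∃ G, l ∉ G ∧ insert l G = H :=
        ⟨H.erase l, by simp, Finset.insert_erase hl⟩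
      simp only [Finset.mem_insert, not_or] at ha hb
      rw [Finset.insert_comm k l, hop_insert (by grind), Finset.insert_comm j k,
        hop_insert (by grind), if_pos (Finset.insert_comm _ _ _),
        hopSign_insert (by grind) (by grind), hopSign_insert (by grind) (by grind)]
      rw [sgn_insert _ _ _ ha.2, sgn_insert _ _ _ ha.2, sgn_insert _ _ _ hb.2,
        sgn_insert _ _ _ hb.2, sgn_insert _ _ _ hlG, sgn_insert _ _ _ hlG]
      simp only [Ne.symm ha.1, Ne.symm hb.1, if_false, if_true, Finset.mem_insert, true_or]
      rw [crossSign_swap hab, crossSign_swap (Ne.symm ha.1), crossSign_swap (Ne.symm hb.1)]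
      linear_combination (-c l j k l * crossSign k l * crossSign j l * sgn k G * sgn j G) *
        (sgn l G * sgn l G * crossSign_mul_self j k + sgn_mul_self l G)
    · rw [show (if l = b then if k = j then if i = a then
          if j ∈ (insert a (insert b H))ᶜ then c a j j b else 0 else 0 else 0 else 0) = 0 by
          split_ifs <;> first | rfl | (exfalso; tauto),
        show (if l = i then if k = a then if j = b then
          if i ∈ H then c i b a i else 0 else 0 else 0 else 0) = 0 by
          split_ifs <;> first | rfl | (exfalso; tauto), sub_zero, mul_zero]
      by_contra hne
      obtain ⟨hij, hkl, hi, hj, hk, hl, hJ⟩ := weitzEntry_term_ne_zero h₁ h₂ hne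
      have hm : ∀ m, m ∈ hop k l (hop i j (insert a H)) ↔ m ∈ insert b H := fun m => by rw [hJ]
      simp only [mem_hop, Finset.mem_insert, Finset.mem_compl] at hm hk hl hi hj hc hc'
      have := hm a
      have := hm b
      have := hm i
      have := hm j
      have := hm k
      have := hm l
      grind
  simp only [weitzEntry, key, ← Finset.mul_sum, Finset.sum_sub_distrib, Finset.sum_ite_eq',
    Finset.mem_univ, if_true, Finset.sum_ite_irrel, Finset.sum_const_zero, Finset.sum_ite_mem,
    Finset.univ_inter]

theorem weitzEntry_term_insert_insert {H : Finset (Fin n)} {a b x y : Fin n}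
    (ha : a ∉ H) (hb : b ∉ H) (hx : x ∉ H) (hy : y ∉ H) (hab : a ≠ b) (hbx : b ≠ x)
    (hxy : x ≠ y) :
    (if hop b y (hop a x (insert a (insert b H))) = insert x (insert y H) then
      c a x b y * (hopSign a x (insert a (insert b H)) *
        hopSign b y (hop a x (insert a (insert b H)))) else 0) =
      -(crossSign b a * crossSign x y * (sgn a H * sgn b H * sgn x H * sgn y H)) *
        c a x b y := by
  rw [hop_insert (by grind), Finset.insert_comm x b, hop_insert (by grind),
    if_pos (Finset.insert_comm _ _ _), hopSign_insert (by grind) (by grind),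
    hopSign_insert (by grind) (by grind), sgn_insert _ _ _ hb, sgn_insert _ _ _ hb,
    sgn_insert _ _ _ hx, sgn_insert _ _ _ hx, crossSign_swap hbx]
  linear_combination (-c a x b y * crossSign b a * crossSign x y * sgn a H * sgn b H * sgn x H *
    sgn y H) * crossSign_mul_self x b

theorem weitzEntry_insert_insert (h₁ : ∀ i k l, c i i k l = 0) (h₂ : ∀ i j k, c i j k k = 0)
    {H : Finset (Fin n)} {a b x y : Fin n}
    (ha : a ∉ H) (hb : b ∉ H) (hx : x ∉ H) (hy : y ∉ H) (hab : a ≠ b) (hax : a ≠ x)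
    (hay : a ≠ y) (hbx : b ≠ x) (hby : b ≠ y) (hxy : x ≠ y) :
    weitzEntry c (insert a (insert b H)) (insert x (insert y H)) =
      -(crossSign b a * crossSign x y * (sgn a H * sgn b H * sgn x H * sgn y H)) *
        (c a x b y - c b x a y - c a y b x + c b y a x) := by
  have key : ∀ i j k l,
      (if hop k l (hop i j (insert a (insert b H))) = insert x (insert y H) then
        c i j k l * (hopSign i j (insert a (insert b H)) *
          hopSign k l (hop i j (insert a (insert b H)))) else 0) =
      -(crossSign b a * crossSign x y * (sgn a H * sgn b H * sgn x H * sgn y H)) *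
      ((if l = y then if k = b then if j = x then if i = a then c a x b y
          else 0 else 0 else 0 else 0) -
       (if l = y then if k = a then if j = x then if i = b then c b x a y
          else 0 else 0 else 0 else 0) -
       (if l = x then if k = b then if j = y then if i = a then c a y b x
          else 0 else 0 else 0 else 0) +
       (if l = x then if k = a then if j = y then if i = b then c b y a x
          else 0 else 0 else 0 else 0)) := by
    intro i j k l
    by_cases e₁ : l = y ∧ k = b ∧ j = x ∧ i = a
    · obtain ⟨rfl, rfl, rfl, rfl⟩ := e₁
      rw [weitzEntry_term_insert_insert ha hb hx hy hab hbx hxy]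
      simp only [hab, hab.symm, hxy, hxy.symm, if_true, if_false]
      ring
    by_cases e₂ : l = y ∧ k = a ∧ j = x ∧ i = b
    · obtain ⟨rfl, rfl, rfl, rfl⟩ := e₂
      rw [Finset.insert_comm k i,
        weitzEntry_term_insert_insert hb ha hx hy hab.symm hax hxy, crossSign_swap hab]
      simp only [hab, hab.symm, hxy, hxy.symm, if_true, if_false]
      ring
    by_cases e₃ : l = x ∧ k = b ∧ j = y ∧ i = a
    · obtain ⟨rfl, rfl, rfl, rfl⟩ := e₃
      rw [Finset.insert_comm l j,
        weitzEntry_term_insert_insert ha hb hy hx hab hby hxy.symm, crossSign_swap hxy]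
      simp only [hab, hab.symm, hxy, hxy.symm, if_true, if_false]
      ring
    by_cases e₄ : l = x ∧ k = a ∧ j = y ∧ i = b
    · obtain ⟨rfl, rfl, rfl, rfl⟩ := e₄
      rw [Finset.insert_comm l j, Finset.insert_comm k i,
        weitzEntry_term_insert_insert hb ha hy hx hab.symm hay hxy.symm,
        crossSign_swap hxy, crossSign_swap hab]
      simp only [hab, hab.symm, hxy, hxy.symm, if_true, if_false]
      ring
    · have vanish : ∀ {a b x y : Fin n} {r : ℝ}, ¬(l = y ∧ k = b ∧ j = x ∧ i = a) →
          (if l = y then if k = b then if j = x then if i = a then r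
            else 0 else 0 else 0 else 0) = 0 := by
        intro a b x y r h
        split_ifs with q₁ q₂ q₃ q₄
        · exact absurd ⟨q₁, q₂, q₃, q₄⟩ h
        all_goals rfl
      rw [vanish e₁, vanish e₂, vanish e₃, vanish e₄]
      simp only [sub_zero, add_zero, mul_zero]
      by_contra hne
      obtain ⟨hij, hkl, hi, hj, hk, hl, hJ⟩ := weitzEntry_term_ne_zero h₁ h₂ hne
      have hm : ∀ m, m ∈ hop k l (hop i j (insert a (insert b H))) ↔ m ∈ insert x (insert y H) :=
        fun m => by rw [hJ]
      simp only [mem_hop, Finset.mem_insert] at hm hk hl hi hj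
      have hai : a = i ∨ a = k := by
        by_contra! h
        exact absurd ((hm a).1 (Or.inr ⟨h.2, Or.inr ⟨h.1, Or.inl rfl⟩⟩)) (by simp [hax, hay, ha])
      have hbi : b = i ∨ b = k := by
        by_contra! h
        exact absurd ((hm b).1 (Or.inr ⟨h.2, Or.inr ⟨h.1, Or.inr (Or.inl rfl)⟩⟩))
          (by simp [hbx, hby, hb])
      have hxj : x = j ∨ x = l := by
        rcases (hm x).2 (Or.inl rfl) with h | ⟨-, h | ⟨-, h | h | h⟩⟩
        exacts [Or.inr h, Or.inl h, absurd h.symm hax, absurd h.symm hbx, absurd h hx]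
      have hyj : y = j ∨ y = l := by
        rcases (hm y).2 (Or.inr (Or.inl rfl)) with h | ⟨-, h | ⟨-, h | h | h⟩⟩
        exacts [Or.inr h, Or.inl h, absurd h.symm hay, absurd h.symm hby, absurd h hy]
      clear hm hi hj hk hl
      rcases hai with rfl | rfl <;> rcases hbi with rfl | rfl <;> rcases hxj with rfl | rfl <;>
        rcases hyj with rfl | rfl <;>
        first
        | exact hab rfl
        | exact hxy rfl
        | exact e₁ ⟨rfl, rfl, rfl, rfl⟩
        | exact e₂ ⟨rfl, rfl, rfl, rfl⟩
        | exact e₃ ⟨rfl, rfl, rfl, rfl⟩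
        | exact e₄ ⟨rfl, rfl, rfl, rfl⟩
  simp only [weitzEntry, key, ← Finset.mul_sum, Finset.sum_sub_distrib, Finset.sum_add_distrib,
    Finset.sum_ite_eq', Finset.mem_univ, if_true]

theorem weitzEntry_eq_zero (h₁ : ∀ i k l, c i i k l = 0) (h₂ : ∀ i j k, c i j k k = 0)
    {I J : Finset (Fin n)} (h : 2 < (I \ J).card) : weitzEntry c I J = 0 := by
  unfold weitzEntry
  refine Finset.sum_eq_zero fun i _ => Finset.sum_eq_zero fun j _ =>
    Finset.sum_eq_zero fun k _ => Finset.sum_eq_zero fun l _ => ?_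
  by_contra hne
  obtain ⟨-, -, -, -, -, -, rfl⟩ := weitzEntry_term_ne_zero h₁ h₂ hne
  have hsub : I \ hop k l (hop i j I) ⊆ {i, k} := by
    intro m hm
    simp only [Finset.mem_sdiff, mem_hop, Finset.mem_insert, Finset.mem_singleton] at hm ⊢
    tauto
  have := (Finset.card_le_card hsub).trans Finset.card_le_two
  omega

end

/-- The sum of the sectional curvatures of the planes spanned by one frame vector indexed by `I`
and one indexed by the complement of `I`. -/
def mixedSectSum {n : ℕ} {V : Type*} [AddCommGroup V] [Module ℝ V] (R : AlgCurv V)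
    (I : Finset (Fin n)) (v : Fin n → V) : ℝ :=
  ∑ i ∈ I, ∑ j ∈ Iᶜ, sectK R (v i) (v j)

theorem exists_perm_sumK_eq {n p : ℕ} {I : Finset (Fin n)} (hI : I.card = p) (hp : p ≤ n) :
    ∃ σ : Equiv.Perm (Fin n), ∀ (R : AlgCurv (EuclideanSpace ℝ (Fin n)))
      (v : Fin n → EuclideanSpace ℝ (Fin n)), sumK R p (v ∘ σ) = mixedSectSum R I v := by
  have hcard : Fintype.card {i : Fin n // (i : ℕ) < p} = Fintype.card {i : Fin n // i ∈ I} := by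
    rw [Fintype.card_coe, hI, Fintype.card_subtype, Fin.card_filter_val_lt, min_eq_right hp]
  let e := Fintype.equivOfCardEq hcard
  have hσ : ∀ i : Fin n, e.extendSubtype i ∈ I ↔ (i : ℕ) < p := fun i =>
    ⟨fun h => by_contra fun hi => e.extendSubtype_not_mem i hi h, fun h => e.extendSubtype_mem i h⟩
  refine ⟨e.extendSubtype, fun R v => ?_⟩
  unfold sumK mixedSectSum
  refine Finset.sum_equiv e.extendSubtype (fun i => by simp [hσ]) fun i _ => ?_
  exact Finset.sum_equiv e.extendSubtype (fun j => by simp [hσ]) fun j _ => rfl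

/-- The frame obtained from `v` by replacing `v a, v b` with `(v a ± s v b) / √2`. -/
def rotFrame {n : ℕ} {V : Type*} [AddCommGroup V] [Module ℝ V] (s : ℝ) (a b : Fin n)
    (v : Fin n → V) : Fin n → V := fun i =>
  if i = a then (√2)⁻¹ • (v a + s • v b) else if i = b then (√2)⁻¹ • (v a - s • v b) else v i

theorem inv_sqrt_two_mul_self : (√2)⁻¹ * (√2)⁻¹ = (1 / 2 : ℝ) := by
  rw [← mul_inv, Real.mul_self_sqrt (by norm_num)]
  norm_num

theorem Orthonormal.rotFrame {n : ℕ} {V : Type*} [NormedAddCommGroup V] [InnerProductSpace ℝ V]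
    {v : Fin n → V} (hv : Orthonormal ℝ v) {s : ℝ} (hs : s * s = 1) {a b : Fin n} (hab : a ≠ b) :
    Orthonormal ℝ (rotFrame s a b v) := by
  rw [orthonormal_iff_ite] at hv ⊢
  have hk := inv_sqrt_two_mul_self
  intro i j
  unfold _root_.rotFrame
  split_ifs <;> subst_vars <;>
    simp only [inner_smul_left, inner_smul_right, inner_add_left, inner_add_right,
      inner_sub_left, inner_sub_right, hv, RCLike.conj_to_real] <;>
    grind

section
variable {V : Type*} [AddCommGroup V] [Module ℝ V] (R : AlgCurv V)

theorem AlgCurv.self_left (x z w : V) : R.T x x z w = 0 := by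
  linarith [R.antisym₁ x x z w]

theorem AlgCurv.self_right (x y z : V) : R.T x y z z = 0 := by
  linarith [R.antisym₂ x y z z]

theorem sectK_rot_left {s : ℝ} (hs : s * s = 1) (x a b : V) :
    sectK R ((√2)⁻¹ • (a + s • b)) x = 1 / 2 * (sectK R a x + sectK R b x) + s * R.T a x x b := by
  have hk := inv_sqrt_two_mul_self
  simp only [sectK, map_add, map_smul, LinearMap.add_apply, LinearMap.smul_apply, smul_eq_mul]
  rw [R.pairsym b x a x, R.antisym₂ a x b x]
  linear_combination (-R.T a x a x + 2 * s * R.T a x x b - s * s * R.T b x b x) * hk -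
    1 / 2 * R.T b x b x * hs

theorem sectK_rot_right {s : ℝ} (hs : s * s = 1) (x a b : V) :
    sectK R x ((√2)⁻¹ • (a - s • b)) = 1 / 2 * (sectK R x a + sectK R x b) - s * R.T x b a x := by
  have hk := inv_sqrt_two_mul_self
  simp only [sectK, map_sub, map_smul, LinearMap.sub_apply, LinearMap.smul_apply, smul_eq_mul]
  rw [R.pairsym x a x b, R.antisym₂ x b x a]
  linear_combination (-R.T x a x a - 2 * s * R.T x b a x - s * s * R.T x b x b) * hk -
    1 / 2 * R.T x b x b * hs

theorem sectK_rot_rot {s : ℝ} (hs : s * s = 1) (a b : V) :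
    sectK R ((√2)⁻¹ • (a + s • b)) ((√2)⁻¹ • (a - s • b)) = sectK R a b := by
  have hk := inv_sqrt_two_mul_self
  simp only [sectK, map_add, map_sub, map_smul, LinearMap.add_apply, LinearMap.sub_apply,
    LinearMap.smul_apply, smul_eq_mul, R.self_left, R.self_right]
  rw [R.antisym₁ b a a b, R.antisym₂ a b b a, R.antisym₁ b a b a, R.antisym₂ a b b a]
  linear_combination (-4 * s * s * R.T a b a b) * ((√2)⁻¹ * (√2)⁻¹ + 1 / 2) * hk -
    R.T a b a b * hs

/-- The part of `sectK R (a + s c) (b - t d)` that is odd in both `s` and `t`. -/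
theorem sectK_rot_polarization (a b c d : V) :
    sectK R ((√2)⁻¹ • (a + (1 : ℝ) • c)) ((√2)⁻¹ • (b - (1 : ℝ) • d))
      - sectK R ((√2)⁻¹ • (a + (1 : ℝ) • c)) ((√2)⁻¹ • (b - (-1 : ℝ) • d))
      - sectK R ((√2)⁻¹ • (a + (-1 : ℝ) • c)) ((√2)⁻¹ • (b - (1 : ℝ) • d))
      + sectK R ((√2)⁻¹ • (a + (-1 : ℝ) • c)) ((√2)⁻¹ • (b - (-1 : ℝ) • d)) =
      2 * (R.T a b c d + R.T a d c b) := by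
  have hk := inv_sqrt_two_mul_self
  simp only [sectK, map_add, map_sub, map_smul, LinearMap.add_apply, LinearMap.sub_apply,
    LinearMap.smul_apply, smul_eq_mul]
  rw [R.pairsym c b a d, R.pairsym c d a b]
  linear_combination 8 * (R.T a b c d + R.T a d c b) * ((√2)⁻¹ * (√2)⁻¹ + 1 / 2) * hk

end

section
variable {n : ℕ} {V : Type*} [AddCommGroup V] [Module ℝ V] (R : AlgCurv V)

theorem compl_insert_eq_insert_compl {H : Finset (Fin n)} {a b : Fin n} (hb : b ∉ H)
    (hab : a ≠ b) : (insert a H)ᶜ = insert b (insert a (insert b H))ᶜ := by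
  ext m
  simp only [Finset.mem_compl, Finset.mem_insert]
  grind

theorem rotFrame_left (s : ℝ) (a b : Fin n) (v : Fin n → V) :
    rotFrame s a b v a = (√2)⁻¹ • (v a + s • v b) := by
  simp [rotFrame]

theorem rotFrame_right (s : ℝ) {a b : Fin n} (hab : a ≠ b) (v : Fin n → V) :
    rotFrame s a b v b = (√2)⁻¹ • (v a - s • v b) := by
  simp [rotFrame, hab.symm]

theorem rotFrame_of_ne (s : ℝ) {a b i : Fin n} (ha : i ≠ a) (hb : i ≠ b) (v : Fin n → V) :
    rotFrame s a b v i = v i := by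
  simp [rotFrame, ha, hb]

theorem mixedSectSum_rotFrame {H : Finset (Fin n)} {a b : Fin n} (ha : a ∉ H) (hb : b ∉ H)
    (hab : a ≠ b) (v : Fin n → V) {s : ℝ} (hs : s * s = 1) :
    mixedSectSum R (insert a H) (rotFrame s a b v) =
      sectK R (v a) (v b)
      + ∑ x ∈ (insert a (insert b H))ᶜ, 1 / 2 * (sectK R (v a) (v x) + sectK R (v b) (v x))
      + ∑ x ∈ H, 1 / 2 * (sectK R (v x) (v a) + sectK R (v x) (v b))
      + ∑ x ∈ H, ∑ y ∈ (insert a (insert b H))ᶜ, sectK R (v x) (v y)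
      + s * (∑ x ∈ (insert a (insert b H))ᶜ, R.T (v a) (v x) (v x) (v b)
        - ∑ x ∈ H, R.T (v x) (v b) (v a) (v x)) := by
  have hX : ∀ x ∈ (insert a (insert b H))ᶜ, rotFrame s a b v x = v x := by
    intro x hx
    simp only [Finset.mem_compl, Finset.mem_insert, not_or] at hx
    exact rotFrame_of_ne s hx.1 hx.2.1 v
  have hH : ∀ x ∈ H, rotFrame s a b v x = v x := fun x hx =>
    rotFrame_of_ne s (ne_of_mem_of_not_mem hx ha) (ne_of_mem_of_not_mem hx hb) v
  have hbX : b ∉ (insert a (insert b H))ᶜ := by simp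
  unfold mixedSectSum
  rw [compl_insert_eq_insert_compl hb hab, Finset.sum_insert ha]
  simp only [Finset.sum_insert hbX]
  have hsumX : ∑ x ∈ (insert a (insert b H))ᶜ,
      sectK R ((√2)⁻¹ • (v a + s • v b)) (rotFrame s a b v x) =
      ∑ x ∈ (insert a (insert b H))ᶜ, (1 / 2 * (sectK R (v a) (v x) + sectK R (v b) (v x))
        + s * R.T (v a) (v x) (v x) (v b)) :=
    Finset.sum_congr rfl fun x hx => by rw [hX x hx, sectK_rot_left R hs]
  rw [rotFrame_left, rotFrame_right s hab, sectK_rot_rot R hs, hsumX,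
    Finset.sum_congr (s₁ := H) rfl fun x hx => by rw [hH x hx, sectK_rot_right R hs,
      Finset.sum_congr rfl fun y hy => by rw [hX y hy]]]
  simp only [Finset.sum_add_distrib, Finset.sum_sub_distrib, ← Finset.mul_sum]
  ring

theorem mixedSectSum_rotFrame_sub {H : Finset (Fin n)} {a b : Fin n} (ha : a ∉ H) (hb : b ∉ H)
    (hab : a ≠ b) (v : Fin n → V) :
    mixedSectSum R (insert a H) (rotFrame 1 a b v)
      - mixedSectSum R (insert a H) (rotFrame (-1) a b v) =
      2 * (∑ x ∈ (insert a (insert b H))ᶜ, R.T (v a) (v x) (v x) (v b)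
        - ∑ x ∈ H, R.T (v x) (v b) (v a) (v x)) := by
  rw [mixedSectSum_rotFrame R ha hb hab v (by norm_num),
    mixedSectSum_rotFrame R ha hb hab v (by norm_num)]
  ring

theorem mixedSectSum_rotFrame_rotFrame {H : Finset (Fin n)} {a b c d : Fin n} (ha : a ∉ H)
    (hb : b ∉ H) (hc : c ∉ H) (hd : d ∉ H) (hab : a ≠ b) (hac : a ≠ c) (had : a ≠ d)
    (hbc : b ≠ c) (hbd : b ≠ d) (hcd : c ≠ d) (v : Fin n → V) (s t : ℝ) :
    mixedSectSum R (insert a (insert b H)) (rotFrame s a c (rotFrame t b d v)) =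
      sectK R ((√2)⁻¹ • (v a + s • v c)) ((√2)⁻¹ • (v a - s • v c))
      + sectK R ((√2)⁻¹ • (v b + t • v d)) ((√2)⁻¹ • (v b - t • v d))
      + sectK R ((√2)⁻¹ • (v a + s • v c)) ((√2)⁻¹ • (v b - t • v d))
      + sectK R ((√2)⁻¹ • (v b + t • v d)) ((√2)⁻¹ • (v a - s • v c))
      + ∑ x ∈ (insert a (insert b (insert c (insert d H))))ᶜ,
          (sectK R ((√2)⁻¹ • (v a + s • v c)) (v x) + sectK R ((√2)⁻¹ • (v b + t • v d)) (v x))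
      + ∑ x ∈ H,
          (sectK R (v x) ((√2)⁻¹ • (v a - s • v c)) + sectK R (v x) ((√2)⁻¹ • (v b - t • v d)))
      + ∑ x ∈ H, ∑ y ∈ (insert a (insert b (insert c (insert d H))))ᶜ, sectK R (v x) (v y) := by
  have hX : ∀ x ∈ (insert a (insert b (insert c (insert d H))))ᶜ,
      rotFrame s a c (rotFrame t b d v) x = v x := by
    intro x hx
    simp only [Finset.mem_compl, Finset.mem_insert, not_or] at hx
    rw [rotFrame_of_ne s hx.1 hx.2.2.1, rotFrame_of_ne t hx.2.1 hx.2.2.2.1]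
  have hH : ∀ x ∈ H, rotFrame s a c (rotFrame t b d v) x = v x := fun x hx => by
    rw [rotFrame_of_ne s (ne_of_mem_of_not_mem hx ha) (ne_of_mem_of_not_mem hx hc),
      rotFrame_of_ne t (ne_of_mem_of_not_mem hx hb) (ne_of_mem_of_not_mem hx hd)]
  have hI : (insert a (insert b H))ᶜ =
      insert c (insert d (insert a (insert b (insert c (insert d H))))ᶜ) := by
    ext m
    simp only [Finset.mem_compl, Finset.mem_insert]
    grind
  have hdX : d ∉ (insert a (insert b (insert c (insert d H))))ᶜ := by simp
  have hcX : c ∉ insert d (insert a (insert b (insert c (insert d H))))ᶜ := by simp [hcd]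
  have haH : a ∉ insert b H := by simp [hab, ha]
  unfold mixedSectSum
  rw [hI, Finset.sum_insert haH, Finset.sum_insert hb]
  simp only [Finset.sum_insert hcX, Finset.sum_insert hdX]
  rw [rotFrame_left, rotFrame_right s hac, rotFrame_of_ne s hab.symm hbc,
    rotFrame_of_ne s had.symm hcd.symm, rotFrame_left, rotFrame_right t hbd,
    rotFrame_of_ne t hab had, rotFrame_of_ne t hbc.symm hcd,
    Finset.sum_congr rfl fun x hx => by rw [hX x hx],
    Finset.sum_congr (s₁ := (insert a (insert b (insert c (insert d H))))ᶜ)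
      (f := fun x => sectK R ((√2)⁻¹ • (v b + t • v d)) (rotFrame s a c (rotFrame t b d v) x))
      rfl fun x hx => by rw [hX x hx],
    Finset.sum_congr (s₁ := H) rfl fun x hx => by rw [hH x hx,
      Finset.sum_congr rfl fun y hy => by rw [hX y hy]]]
  simp only [Finset.sum_add_distrib]
  ring

theorem mixedSectSum_polarization {H : Finset (Fin n)} {a b c d : Fin n} (ha : a ∉ H)
    (hb : b ∉ H) (hc : c ∉ H) (hd : d ∉ H) (hab : a ≠ b) (hac : a ≠ c) (had : a ≠ d)
    (hbc : b ≠ c) (hbd : b ≠ d) (hcd : c ≠ d) (v : Fin n → V) :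
    mixedSectSum R (insert a (insert b H)) (rotFrame 1 a c (rotFrame 1 b d v))
      - mixedSectSum R (insert a (insert b H)) (rotFrame 1 a c (rotFrame (-1) b d v))
      - mixedSectSum R (insert a (insert b H)) (rotFrame (-1) a c (rotFrame 1 b d v))
      + mixedSectSum R (insert a (insert b H)) (rotFrame (-1) a c (rotFrame (-1) b d v)) =
      4 * (R.T (v a) (v b) (v c) (v d) + R.T (v a) (v d) (v c) (v b)) := by
  simp only [mixedSectSum_rotFrame_rotFrame R ha hb hc hd hab hac had hbc hbd hcd,
    Finset.sum_add_distrib]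
  have h₁ := sectK_rot_polarization R (v a) (v b) (v c) (v d)
  have h₂ := sectK_rot_polarization R (v b) (v a) (v d) (v c)
  rw [R.antisym₁ (v b) (v a), R.antisym₂ (v a) (v b) (v d), R.pairsym (v b) (v c),
    R.antisym₁ (v d), R.antisym₂ (v a) (v d) (v b)] at h₂
  linear_combination h₁ + h₂

end

/-- The bound, in units of the pinching width, on a matrix entry whose index sets differ in
`r` elements. -/
def entryBound (r : ℕ) : ℝ := if r = 1 then 1 / 2 else if r = 2 then 4 / 3 else 0

theorem abs_weitzEntry_le {n p : ℕ} (R : AlgCurv (EuclideanSpace ℝ (Fin n))) {m M : ℝ}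
    (hpinch : ∀ v : Fin n → EuclideanSpace ℝ (Fin n), Orthonormal ℝ v →
      ∀ I : Finset (Fin n), I.card = p → m ≤ mixedSectSum R I v ∧ mixedSectSum R I v ≤ M)
    {I J : Finset (Fin n)} (hI : I.card = p) (hJ : J.card = p) (hIJ : I ≠ J) :
    |weitzEntry (fun i j k l => R.T (estd i) (estd j) (estd k) (estd l)) I J| ≤
      entryBound (I \ J).card * (M - m) := by
  have hstd : Orthonormal ℝ (estd : Fin n → EuclideanSpace ℝ (Fin n)) := by
    exact EuclideanSpace.orthonormal_single
  have h₁ : ∀ i k l : Fin n, R.T (estd i) (estd i) (estd k) (estd l) = 0 :=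
    fun i k l => R.self_left _ _ _
  have h₂ : ∀ i j k : Fin n, R.T (estd i) (estd j) (estd k) (estd k) = 0 :=
    fun i j k => R.self_right _ _ _
  have hcomm : (J \ I).card = (I \ J).card := Finset.card_sdiff_comm (hJ.trans hI.symm)
  have hIeq : (I \ J) ∪ (I ∩ J) = I := Finset.sdiff_union_inter I J
  have hJeq : (J \ I) ∪ (I ∩ J) = J := by rw [Finset.inter_comm]; exact Finset.sdiff_union_inter J I
  have h11 : (1 : ℝ) * 1 = 1 := by norm_num
  have hn11 : (-1 : ℝ) * -1 = 1 := by norm_num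
  have h0 : (I \ J).card ≠ 0 := by
    intro h
    rw [Finset.card_eq_zero, Finset.sdiff_eq_empty_iff_subset] at h
    exact hIJ (Finset.eq_of_subset_of_card_le h (by omega))
  rcases (by omega : (I \ J).card = 1 ∨ (I \ J).card = 2 ∨ 2 < (I \ J).card) with h | h | h
  · rw [h] at hcomm ⊢
    obtain ⟨a, ha⟩ := Finset.card_eq_one.1 h
    obtain ⟨b, hb⟩ := Finset.card_eq_one.1 hcomm
    have haH : a ∈ I \ J := by simp [ha]
    have hbH : b ∈ J \ I := by simp [hb]
    rw [Finset.mem_sdiff] at haH hbH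
    rw [ha, Finset.singleton_union] at hIeq
    rw [hb, Finset.singleton_union] at hJeq
    have haH' : a ∉ I ∩ J := by simp [haH]
    have hbH' : b ∉ I ∩ J := by simp [hbH]
    have hab : a ≠ b := by rintro rfl; exact hbH.2 haH.1
    have hsub := mixedSectSum_rotFrame_sub R haH' hbH' hab estd
    have hentry := weitzEntry_insert
      (c := fun i j k l => R.T (estd i) (estd j) (estd k) (estd l)) h₁ h₂ haH' hbH' hab
    rw [hIeq, hJeq] at hsub
    rw [hIeq, hJeq] at hentry
    rw [hentry, abs_mul, abs_mul, abs_sgn, abs_sgn, one_mul, one_mul, abs_le, entryBound,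
      if_pos rfl]
    have := hpinch _ (hstd.rotFrame h11 hab) I hI
    have := hpinch _ (hstd.rotFrame hn11 hab) I hI
    constructor <;> linarith
  · rw [h] at hcomm ⊢
    obtain ⟨a, b, hab, ha⟩ := Finset.card_eq_two.1 h
    obtain ⟨c, d, hcd, hb⟩ := Finset.card_eq_two.1 hcomm
    have haI : a ∈ I \ J := by simp [ha]
    have hbI : b ∈ I \ J := by simp [ha]
    have hcJ : c ∈ J \ I := by simp [hb]
    have hdJ : d ∈ J \ I := by simp [hb]
    rw [Finset.mem_sdiff] at haI hbI hcJ hdJ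
    rw [ha, Finset.insert_union, Finset.singleton_union] at hIeq
    rw [hb, Finset.insert_union, Finset.singleton_union] at hJeq
    have ha' : a ∉ I ∩ J := by simp [haI]
    have hb' : b ∉ I ∩ J := by simp [hbI]
    have hc' : c ∉ I ∩ J := by simp [hcJ]
    have hd' : d ∉ I ∩ J := by simp [hdJ]
    have hac : a ≠ c := by rintro rfl; exact hcJ.2 haI.1
    have had : a ≠ d := by rintro rfl; exact hdJ.2 haI.1
    have hbc : b ≠ c := by rintro rfl; exact hcJ.2 hbI.1
    have hbd : b ≠ d := by rintro rfl; exact hdJ.2 hbI.1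
    have hpol₁ := mixedSectSum_polarization R ha' hb' hc' hd' hab hac had hbc hbd hcd estd
    have hpol₂ := mixedSectSum_polarization R ha' hb' hd' hc' hab had hac hbd hbc hcd.symm estd
    have hentry := weitzEntry_insert_insert
      (c := fun i j k l => R.T (estd i) (estd j) (estd k) (estd l)) h₁ h₂ ha' hb' hc' hd' hab hac had hbc hbd hcd
    rw [hIeq] at hpol₁ hpol₂
    rw [hIeq, hJeq] at hentry
    rw [hentry, abs_mul, abs_neg]
    simp only [abs_mul, abs_sgn, abs_crossSign, one_mul]
    rw [abs_le, entryBound, if_neg (by norm_num), if_pos rfl]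
    have b₁ : ∀ {s t : ℝ}, s * s = 1 → t * t = 1 → _ := fun hs ht =>
      hpinch _ ((hstd.rotFrame ht hbd).rotFrame hs hac) I hI
    have b₂ : ∀ {s t : ℝ}, s * s = 1 → t * t = 1 → _ := fun hs ht =>
      hpinch _ ((hstd.rotFrame ht hbc).rotFrame hs had) I hI
    have := b₁ h11 h11
    have := b₁ h11 hn11
    have := b₁ hn11 h11
    have := b₁ hn11 hn11
    have := b₂ h11 h11
    have := b₂ h11 hn11
    have := b₂ hn11 h11
    have := b₂ hn11 hn11
    have e₁ := R.bianchi (estd a) (estd b) (estd c) (estd d)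
    have e₂ := R.antisym₁ (estd c) (estd a) (estd b) (estd d)
    have e₃ := R.pairsym (estd b) (estd d) (estd a) (estd c)
    have e₄ := R.pairsym (estd a) (estd d) (estd b) (estd c)
    have e₅ := R.antisym₂ (estd a) (estd b) (estd d) (estd c)
    have e₆ := R.antisym₂ (estd a) (estd d) (estd c) (estd b)
    have e₇ := R.antisym₂ (estd a) (estd c) (estd d) (estd b)
    constructor <;> linarith
  · rw [weitzEntry_eq_zero h₁ h₂ h, entryBound, if_neg (by omega), if_neg (by omega)]
    simp

/-- A Gershgorin-type criterion for positivity of a quadratic form. -/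
theorem sum_sum_mul_pos_of_diagonal_dominant {ι : Type*} [DecidableEq ι] (P : Finset ι)
    (M N : ι → ι → ℝ) (D : ℝ) (hself : ∀ i ∈ P, N i i = 0)
    (hN : ∀ i ∈ P, ∀ j ∈ P, i ≠ j → |M i j| ≤ N i j)
    (hsymm : ∀ i ∈ P, ∀ j ∈ P, N i j = N j i) (hrow : ∀ i ∈ P, ∑ j ∈ P, N i j ≤ D)
    (hdiag : ∀ i ∈ P, D < M i i) (f : ι → ℝ) (hf : ∃ i ∈ P, f i ≠ 0) :
    0 < ∑ i ∈ P, ∑ j ∈ P, M i j * f j * f i := by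
  have hterm : ∀ i ∈ P, ∀ j ∈ P, (if j = i then M i i * f i ^ 2 else 0)
      - N i j * (f i ^ 2 / 2) - N i j * (f j ^ 2 / 2) ≤ M i j * f j * f i := by
    intro i hi j hj
    split_ifs with h
    · subst h
      rw [hself j hj]
      linarith [sq (f j)]
    · have hM := abs_le.1 (hN i hi j hj (Ne.symm h))
      nlinarith [mul_nonneg (by linarith [hM.1] : 0 ≤ M i j + N i j) (sq_nonneg (f i + f j)),
        mul_nonneg (by linarith [hM.2] : 0 ≤ N i j - M i j) (sq_nonneg (f i - f j))]
  have hsum : ∑ i ∈ P, ∑ j ∈ P, N i j * (f j ^ 2 / 2) = ∑ i ∈ P, ∑ j ∈ P, N i j * (f i ^ 2 / 2) := by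
    rw [Finset.sum_comm]
    exact Finset.sum_congr rfl fun i hi => Finset.sum_congr rfl fun j hj => by rw [hsymm j hj i hi]
  calc 0 < ∑ i ∈ P, (M i i - ∑ j ∈ P, N i j) * f i ^ 2 := by
        obtain ⟨i, hi, hfi⟩ := hf
        have hpos : ∀ i ∈ P, 0 < M i i - ∑ j ∈ P, N i j := fun i hi => by
          linarith [hrow i hi, hdiag i hi]
        exact Finset.sum_pos' (fun i hi => mul_nonneg (hpos i hi).le (sq_nonneg _))
          ⟨i, hi, mul_pos (hpos i hi) (by positivity)⟩
    _ = ∑ i ∈ P, ∑ j ∈ P, ((if j = i then M i i * f i ^ 2 else 0)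
          - N i j * (f i ^ 2 / 2) - N i j * (f j ^ 2 / 2)) := by
        simp only [Finset.sum_sub_distrib, hsum, Finset.sum_ite_eq', ← Finset.sum_mul]
        rw [← Finset.sum_sub_distrib, ← Finset.sum_sub_distrib]
        refine Finset.sum_congr rfl fun i hi => ?_
        rw [if_pos hi]
        ring
    _ ≤ _ := Finset.sum_le_sum fun i hi => Finset.sum_le_sum fun j hj => hterm i hi j hj

theorem card_filter_card_sdiff_le {n p : ℕ} {I : Finset (Fin n)} (hI : I.card = p) (r : ℕ) :
    (((Finset.univ.powersetCard p).filter fun J => (I \ J).card = r).card) ≤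
      p.choose r * (n - p).choose r := by
  have hcard : (I.powersetCard r ×ˢ Iᶜ.powersetCard r).card = p.choose r * (n - p).choose r := by
    rw [Finset.card_product, Finset.card_powersetCard, Finset.card_powersetCard, hI,
      Finset.card_compl, hI, Fintype.card_fin]
  rw [← hcard]
  refine Finset.card_le_card_of_injOn (fun J => (I \ J, J \ I)) ?_ ?_
  · intro J hJ
    simp only [Finset.coe_filter, Finset.mem_powersetCard_univ, Set.mem_ofPred_eq] at hJ
    simp only [Finset.coe_product, Set.mem_prod, Finset.mem_coe, Finset.mem_powersetCard]
    refine ⟨⟨Finset.sdiff_subset, hJ.2⟩, fun m hm => ?_, ?_⟩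
    · simp only [Finset.mem_sdiff] at hm
      simp [hm.2]
    · rw [Finset.card_sdiff_comm (hJ.1.trans hI.symm), hJ.2]
  · intro J _ J' _ h
    simp only [Prod.mk.injEq, Finset.ext_iff, Finset.mem_sdiff] at h
    ext m
    have := h.1 m
    have := h.2 m
    tauto

theorem sum_entryBound_le {n p : ℕ} {I : Finset (Fin n)} (hI : I.card = p) :
    ∑ J ∈ Finset.univ.powersetCard p, entryBound (I \ J).card ≤ Dconst n p := by
  have hsplit : ∀ r, entryBound r = (if r = 1 then 1 / 2 else 0) + if r = 2 then 4 / 3 else 0 := by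
    intro r
    unfold entryBound
    split_ifs <;> first | (exfalso; omega) | norm_num
  simp only [hsplit, Finset.sum_add_distrib, ← Finset.sum_filter, Finset.sum_const, nsmul_eq_mul]
  have c₁ := card_filter_card_sdiff_le hI 1
  have c₂ := card_filter_card_sdiff_le hI 2
  rw [Nat.choose_one_right, Nat.choose_one_right] at c₁
  have c₁' : (_ : ℝ) ≤ _ := Nat.cast_le.2 c₁
  have c₂' : (_ : ℝ) ≤ _ := Nat.cast_le.2 c₂
  unfold Dconst
  linarith

theorem extInner_weitz_eq {n p : ℕ} (R : AlgCurv (EuclideanSpace ℝ (Fin n))) {ω : ExtCoord n}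
    (hω : ∀ S, S.card ≠ p → ω S = 0) :
    extInner (weitz R ω) ω = ∑ I ∈ Finset.univ.powersetCard p, ∑ J ∈ Finset.univ.powersetCard p,
      weitzEntry (fun i j k l => R.T (estd i) (estd j) (estd k) (estd l)) I J * ω J * ω I := by
  have hsub : ∀ g : Finset (Fin n) → ℝ, (∀ S, S.card ≠ p → g S = 0) →
      ∑ S, g S = ∑ S ∈ Finset.univ.powersetCard p, g S := fun g hg =>
    (Finset.sum_subset (Finset.subset_univ _) fun S _ hS =>
      hg S (by simpa [Finset.mem_powersetCard_univ] using hS)).symm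
  unfold extInner weitz
  rw [hsub _ fun S hS => by rw [hω S hS, mul_zero]]
  refine Finset.sum_congr rfl fun I _ => ?_
  rw [weitzOp_apply, hsub _ fun S hS => by rw [hω S hS, mul_zero], Finset.sum_mul]

/-- Theorem 3.1, pointwise form. If the sums of sectional curvatures
`Σ_{i≤p} Σ_{j>p} K(vⁱ,vʲ)` over all orthonormal bases are pinched between `C(n,p)·A`
and `A` for some `A > 0`, then the Weitzenböck operator `R^p` is positive definite. -/
theorem statement0 (n p : ℕ) (hn : 4 ≤ n) (hp2 : 2 ≤ p) (hpn : p ≤ n - 2)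
    (R : AlgCurv (EuclideanSpace ℝ (Fin n))) (A : ℝ) (hA : 0 < A)
    (hpinch : ∀ v : Fin n → EuclideanSpace ℝ (Fin n), Orthonormal ℝ v →
      Cnp n p * A < sumK R p v ∧ sumK R p v < A)
    (ω : ExtCoord n) (hω : ∀ S, S.card ≠ p → ω S = 0) (hne : ω ≠ 0) :
    0 < extInner (weitz R ω) ω := by
  have hpinch' : ∀ v : Fin n → EuclideanSpace ℝ (Fin n), Orthonormal ℝ v →
      ∀ I : Finset (Fin n), I.card = p →
        Cnp n p * A < mixedSectSum R I v ∧ mixedSectSum R I v < A := by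
    intro v hv I hI
    obtain ⟨σ, hσ⟩ := exists_perm_sumK_eq hI (by omega)
    rw [← hσ]
    exact hpinch _ (hv.comp σ σ.injective)
  have hstd : Orthonormal ℝ (estd : Fin n → EuclideanSpace ℝ (Fin n)) := by
    exact EuclideanSpace.orthonormal_single
  have hD : 0 ≤ Dconst n p := by unfold Dconst; positivity
  have hwidth : Dconst n p * (A - Cnp n p * A) = Cnp n p * A := by
    unfold Cnp
    field_simp
    ring
  have hwidth_nonneg : 0 ≤ A - Cnp n p * A := by
    have : A - Cnp n p * A = A / (1 + Dconst n p) := by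
      unfold Cnp
      field_simp
      ring
    rw [this]
    positivity
  rw [extInner_weitz_eq R hω]
  refine sum_sum_mul_pos_of_diagonal_dominant _ _
    (fun I J => entryBound (I \ J).card * (A - Cnp n p * A)) (Cnp n p * A)
    ?_ ?_ ?_ ?_ ?_ ω ?_ <;> simp only [Finset.mem_powersetCard_univ]
  · intro I _
    simp [entryBound]
  · exact fun I hI J hJ hIJ => abs_weitzEntry_le R
      (fun v hv I hI => (hpinch' v hv I hI).imp le_of_lt le_of_lt) hI hJ hIJ
  · intro I hI J hJ
    rw [Finset.card_sdiff_comm (hI.trans hJ.symm)]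
  · intro I hI
    rw [← Finset.sum_mul]
    exact (mul_le_mul_of_nonneg_right (sum_entryBound_le hI) hwidth_nonneg).trans_eq hwidth
  · intro I hI
    rw [weitzEntry_self (fun i k l => R.self_left _ _ _) (fun i j k => R.self_right _ _ _)]
    refine (hpinch' _ hstd I hI).1.trans_eq (Finset.sum_congr rfl fun i _ =>
      Finset.sum_congr rfl fun j _ => ?_)
    rw [sectK, R.antisym₂, neg_neg]
  · obtain ⟨S, hS⟩ := Function.ne_iff.1 hne
    exact ⟨S, by_contra fun h => hS (hω S h), hS⟩

end
end

section
/- Let V be a real inner product space of dimension at least 4, let T be an algebraic curvature tensor on V, and let B ≤ A be real numbers such that B ≤ T(x,y,x,y) ≤ A for every orthonormal pair (x,y) of vectors in V. Then for every orthonormal 4-tuple (u,v,w,z) of vectors in V, |T(u,v,w,z)| ≤ (4/3)·(A−B). -/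
open scoped BigOperators RealInnerProductSpace

noncomputable section

/-- Curvature pinching on orthogonal pairs of vectors of squared norm `2`. -/
lemma AlgCurv.pinch_of_inner_self_eq_two {V : Type*} [NormedAddCommGroup V]
    [InnerProductSpace ℝ V] (T : AlgCurv V) {A B : ℝ}
    (hpinch : ∀ x y : V, Orthonormal ℝ ![x, y] →
      B ≤ T.T x y x y ∧ T.T x y x y ≤ A)
    {p q : V} (hp : inner ℝ p p = 2) (hq : inner ℝ q q = 2) (hpq : inner ℝ p q = 0) :
    4 * B ≤ T.T p q p q ∧ T.T p q p q ≤ 4 * A := by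
  obtain ⟨c, hc⟩ : ∃ c : ℝ, c * c = 1 / 2 :=
    ⟨√(1 / 2), Real.mul_self_sqrt (by norm_num)⟩
  have hqp : inner ℝ q p = 0 := by rw [real_inner_comm]; exact hpq
  have h := hpinch (c • p) (c • q) (by
    rw [orthonormal_iff_ite]
    intro i j
    fin_cases i <;> fin_cases j
    · change inner ℝ (c • p) (c • p) = 1
      rw [real_inner_smul_left, real_inner_smul_right, hp]; linarith
    · change inner ℝ (c • p) (c • q) = 0
      simp [real_inner_smul_left, real_inner_smul_right, hpq]
    · change inner ℝ (c • q) (c • p) = 0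
      simp [real_inner_smul_left, real_inner_smul_right, hqp]
    · change inner ℝ (c • q) (c • q) = 1
      rw [real_inner_smul_left, real_inner_smul_right, hq]; linarith)
  simp only [map_smul, LinearMap.smul_apply, smul_eq_mul] at h
  have e : c * (c * (c * (c * T.T p q p q))) = T.T p q p q / 4 := by
    linear_combination (c * c + 1 / 2) * T.T p q p q * hc
  constructor <;> linarith [h.1, h.2]

/-- Polarization estimate for an orthonormal 4-tuple under curvature pinching. -/
lemma AlgCurv.abs_add_swap_le {V : Type*} [NormedAddCommGroup V]
    [InnerProductSpace ℝ V] (T : AlgCurv V) {A B : ℝ}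
    (hpinch : ∀ x y : V, Orthonormal ℝ ![x, y] →
      B ≤ T.T x y x y ∧ T.T x y x y ≤ A)
    {x y z w : V} (h : Orthonormal ℝ ![x, y, z, w]) :
    |T.T x y z w + T.T x w z y| ≤ A - B := by
  rw [orthonormal_iff_ite] at h
  have hxx : inner ℝ x x = 1 := h 0 0
  have hyy : inner ℝ y y = 1 := h 1 1
  have hzz : inner ℝ z z = 1 := h 2 2
  have hww : inner ℝ w w = 1 := h 3 3
  have hxy : inner ℝ x y = 0 := h 0 1
  have hxz : inner ℝ x z = 0 := h 0 2
  have hzx : inner ℝ z x = 0 := h 2 0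
  have hxw : inner ℝ x w = 0 := h 0 3
  have hzy : inner ℝ z y = 0 := h 2 1
  have hyw : inner ℝ y w = 0 := h 1 3
  have hwy : inner ℝ w y = 0 := h 3 1
  have hzw : inner ℝ z w = 0 := h 2 3
  have hp : inner ℝ (x + z) (x + z) = 2 := by
    simp only [inner_add_left, inner_add_right, hxx, hzz, hxz, hzx]; norm_num
  have hm : inner ℝ (x - z) (x - z) = 2 := by
    simp only [inner_sub_left, inner_sub_right, hxx, hzz, hxz, hzx]; norm_num
  have hp' : inner ℝ (y + w) (y + w) = 2 := by
    simp only [inner_add_left, inner_add_right, hyy, hww, hyw, hwy]; norm_num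
  have hm' : inner ℝ (y - w) (y - w) = 2 := by
    simp only [inner_sub_left, inner_sub_right, hyy, hww, hyw, hwy]; norm_num
  have h1 := T.pinch_of_inner_self_eq_two hpinch hp hp' (by
    simp [inner_add_left, inner_add_right, hxy, hxw, hzy, hzw])
  have h2 := T.pinch_of_inner_self_eq_two hpinch hp hm' (by
    simp [inner_add_left, inner_sub_right, hxy, hxw, hzy, hzw])
  have h3 := T.pinch_of_inner_self_eq_two hpinch hm hp' (by
    simp [inner_sub_left, inner_add_right, hxy, hxw, hzy, hzw])
  have h4 := T.pinch_of_inner_self_eq_two hpinch hm hm' (by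
    simp [inner_sub_left, inner_sub_right, hxy, hxw, hzy, hzw])
  have hsub (a b c : V) : T.T (x - z) a b c = T.T x a b c - T.T z a b c := by
    rw [T.antisym₁, T.antisym₁ x, T.antisym₁ z]
    simp only [map_sub, LinearMap.sub_apply]
    ring
  simp only [hsub, map_add, map_sub, LinearMap.add_apply, LinearMap.sub_apply] at h1 h2 h3 h4
  have e1 := T.pairsym x y z w
  have e2 := T.pairsym x w z y
  rw [abs_le]
  constructor <;> linarith [h1.1, h1.2, h2.1, h2.2, h3.1, h3.2, h4.1, h4.2]

/-- estimate (3.6). If `B ≤ T(x,y,x,y) ≤ A` for all orthonormal pairs,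
then `|T(u,v,w,z)| ≤ (4/3)(A−B)` for all orthonormal 4-tuples. -/
theorem statement7 {V : Type*} [NormedAddCommGroup V] [InnerProductSpace ℝ V]
    (hdim : 4 ≤ Module.rank ℝ V)
    (T : AlgCurv V) (A B : ℝ) (hBA : B ≤ A)
    (hpinch : ∀ x y : V, Orthonormal ℝ ![x, y] →
      B ≤ T.T x y x y ∧ T.T x y x y ≤ A)
    (u v w z : V) (huvwz : Orthonormal ℝ ![u, v, w, z]) :
    |T.T u v w z| ≤ 4 / 3 * (A - B) := by
  have hswap : Orthonormal ℝ ![v, u, w, z] := by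
    convert huvwz.comp (Equiv.swap 0 1) (Equiv.injective _) using 1
    ext i
    fin_cases i <;> rfl
  have h1 := abs_le.mp (T.abs_add_swap_le hpinch huvwz)
  have h2 := abs_le.mp (T.abs_add_swap_le hpinch hswap)
  have e1 := T.bianchi u v w z
  have e2 := T.pairsym u z w v
  have e3 := T.antisym₁ w v u z
  have e4 := T.antisym₁ v u w z
  have e5 := T.pairsym v z w u
  rw [abs_le]
  constructor <;> linarith [h1.1, h1.2, h2.1, h2.2]

end
end

section
/- Let 1 ≤ k ≤ p ≤ n and let a be an assignment of a real number a_I to each p-element subset I of {1,…,n}. Then the sum, over all ordered pairs (I,J) of p-element subsets of {1,…,n} with |I ∩ J| = k, of |a_I|·|a_J| is at most binom(p, p−k)·binom(n−p, p−k) · Σ_I a_I², where the last sum runs over all p-element subsets I of {1,…,n}. -/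
open scoped BigOperators RealInnerProductSpace

noncomputable section

/-- Splitting `J` as `(J ∩ I) ∪ (J \ I)` counts the `p`-sets meeting `I` in `k` elements. -/
theorem card_filter_card_inter_eq {α : Type*} [Fintype α] [DecidableEq α] (I : Finset α)
    {p k : ℕ} (hkp : k ≤ p) :
    (Finset.univ.filter fun J : Finset α => J.card = p ∧ (I ∩ J).card = k).card =
      I.card.choose k * (Fintype.card α - I.card).choose (p - k) := by
  rw [← Finset.card_compl, ← Finset.card_powersetCard, ← Finset.card_powersetCard,
    ← Finset.card_product]
  refine Finset.card_bij' (fun J _ => (I ∩ J, Iᶜ ∩ J)) (fun X _ => X.1 ∪ X.2) ?_ ?_ ?_ ?_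
  · intro J hJ
    obtain ⟨hJp, hJk⟩ := (Finset.mem_filter.mp hJ).2
    have h := Finset.card_inter_add_card_sdiff J I
    rw [Finset.inter_comm, Finset.sdiff_eq_inter_compl, Finset.inter_comm J Iᶜ] at h
    simp only [Finset.mem_product, Finset.mem_powersetCard]
    exact ⟨⟨Finset.inter_subset_left, hJk⟩, Finset.inter_subset_left, by omega⟩
  · rintro ⟨X, Y⟩ hXY
    simp only [Finset.mem_product, Finset.mem_powersetCard] at hXY
    obtain ⟨⟨hX, hXk⟩, hY, hYk⟩ := hXY
    have hd : Disjoint X Y := (disjoint_compl_right (a := I)).mono hX hY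
    have hI : I ∩ (X ∪ Y) = X := by
      ext x
      have := @hX x
      have := @hY x
      simp only [Finset.mem_compl, Finset.mem_inter, Finset.mem_union] at *
      tauto
    simp only [Finset.mem_filter, Finset.mem_univ, true_and, hI,
      Finset.card_union_of_disjoint hd]
    omega
  · intro J _
    ext x
    simp only [Finset.mem_compl, Finset.mem_inter, Finset.mem_union]
    tauto
  · rintro ⟨X, Y⟩ hXY
    simp only [Finset.mem_product, Finset.mem_powersetCard] at hXY
    obtain ⟨⟨hX, _⟩, hY, _⟩ := hXY
    ext x <;>
    · have := @hX x
      have := @hY x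
      simp only [Finset.mem_compl, Finset.mem_inter, Finset.mem_union] at *
      tauto

/-- Schur's test for a symmetric relation of constant degree `d` on a finite set. -/
theorem sum_filter_abs_mul_abs_le {ι : Type*} (s : Finset ι) (r : ι → ι → Prop)
    [∀ i j, Decidable (r i j)] (hr : ∀ i j, r i j → r j i) (d : ℕ)
    (hd : ∀ i ∈ s, (s.filter (r i)).card = d) (a : ι → ℝ) :
    ∑ i ∈ s, ∑ j ∈ s.filter (r i), |a i| * |a j| ≤ d * ∑ i ∈ s, a i ^ 2 := by
  have hrow : ∑ i ∈ s, ∑ _j ∈ s.filter (r i), a i ^ 2 = d * ∑ i ∈ s, a i ^ 2 := by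
    rw [Finset.mul_sum]
    refine Finset.sum_congr rfl fun i hi => ?_
    rw [Finset.sum_const, hd i hi, nsmul_eq_mul]
  have hcol : ∑ i ∈ s, ∑ j ∈ s.filter (r i), a j ^ 2 = d * ∑ i ∈ s, a i ^ 2 := by
    rw [← hrow]
    refine Finset.sum_comm' fun i j => ?_
    simp only [Finset.mem_filter]
    exact ⟨fun h => ⟨⟨h.1, hr _ _ h.2.2⟩, h.2.1⟩, fun h => ⟨h.1.1, h.2, hr _ _ h.1.2⟩⟩
  calc ∑ i ∈ s, ∑ j ∈ s.filter (r i), |a i| * |a j|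
      ≤ ∑ i ∈ s, ∑ j ∈ s.filter (r i), (a i ^ 2 + a j ^ 2) / 2 := by
        refine Finset.sum_le_sum fun i _ => Finset.sum_le_sum fun j _ => ?_
        have := two_mul_le_add_sq |a i| |a j|
        rw [sq_abs, sq_abs] at this
        linarith
    _ = d * ∑ i ∈ s, a i ^ 2 := by
        simp only [← Finset.sum_div, Finset.sum_add_distrib, hrow, hcol]
        ring

/-- Lemma 3.2. `Σ_{|I∩J|=k} |a_I||a_J| ≤ binom(p,p−k)·binom(n−p,p−k)·Σ a_I²`. -/
theorem statement8 (n p k : ℕ) (hk1 : 1 ≤ k) (hkp : k ≤ p) (hpn : p ≤ n)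
    (a : Finset (Fin n) → ℝ) :
    ∑ I ∈ Finset.univ.filter (fun I : Finset (Fin n) => I.card = p),
      ∑ J ∈ Finset.univ.filter (fun J : Finset (Fin n) =>
          J.card = p ∧ (I ∩ J).card = k),
        |a I| * |a J|
      ≤ (p.choose (p - k) : ℝ) * ((n - p).choose (p - k) : ℝ) *
          ∑ I ∈ Finset.univ.filter (fun I : Finset (Fin n) => I.card = p), (a I) ^ 2 := by
  have hdeg : ∀ I ∈ Finset.univ.filter (fun I : Finset (Fin n) => I.card = p),
      ((Finset.univ.filter fun J : Finset (Fin n) => J.card = p).filter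
        fun J => (I ∩ J).card = k).card = p.choose (p - k) * (n - p).choose (p - k) := by
    intro I hI
    rw [Finset.filter_filter, card_filter_card_inter_eq I hkp, (Finset.mem_filter.mp hI).2,
      Fintype.card_fin, Nat.choose_symm hkp]
  have h := sum_filter_abs_mul_abs_le _ (fun I J : Finset (Fin n) => (I ∩ J).card = k)
    (fun I J hIJ => by rwa [Finset.inter_comm]) _ hdeg a
  simpa only [Finset.filter_filter, Nat.cast_mul] using h

end
end

section
/- Let n ≥ 4 and 2 ≤ p ≤ n−2, let B ≤ A be real numbers, and set D = (1/2)·p(n−p) + (4/3)·binom(p,2)·binom(n−p,2). Suppose B ≥ D·(A−B). Let M be a real matrix whose rows and columns are indexed by the p-element subsets of {1,…,n} and which satisfies: M_{II} > B for every I; |M_{IJ}| ≤ (A−B)/2 whenever |I ∩ J| = p−1; |M_{IJ}| ≤ (4/3)(A−B) whenever |I ∩ J| = p−2; and M_{IJ} = 0 whenever |I ∩ J| ≤ p−3. Then for every nonzero family (a_I) of real numbers indexed by the p-element subsets of {1,…,n}, Σ_{I,J} a_I · M_{IJ} · a_J > 0. -/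
open scoped BigOperators RealInnerProductSpace

noncomputable section

/-- At most `p.choose k * (n - p).choose k` subsets of cardinality `p` meet a given one in `p - k`
elements. -/
theorem card_filter_inter_add_eq_le {n p : ℕ} (k : ℕ) (I : {I : Finset (Fin n) // I.card = p}) :
    (Finset.univ.filter fun J : {I : Finset (Fin n) // I.card = p} =>
      ((I : Finset (Fin n)) ∩ (J : Finset (Fin n))).card + k = p).card ≤
      p.choose k * (n - p).choose k := by
  have hcard : ((I : Finset (Fin n)).powersetCard k ×ˢ
      (I : Finset (Fin n))ᶜ.powersetCard k).card = p.choose k * (n - p).choose k := by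
    rw [Finset.card_product, Finset.card_powersetCard, Finset.card_powersetCard,
      Finset.card_compl, I.2, Fintype.card_fin]
  rw [← hcard]
  refine Finset.card_le_card_of_injOn
    (fun J => ((I : Finset (Fin n)) \ J, (J : Finset (Fin n)) \ I)) ?_ ?_
  · intro J hJ
    have hJ' : ((I : Finset (Fin n)) ∩ (J : Finset (Fin n))).card + k = p := by simpa using hJ
    have hI := Finset.card_inter_add_card_sdiff (I : Finset (Fin n)) J
    have hJI := Finset.card_inter_add_card_sdiff (J : Finset (Fin n)) I
    rw [I.2] at hI
    rw [J.2, Finset.inter_comm] at hJI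
    simp only [Finset.mem_coe, Finset.mem_product, Finset.mem_powersetCard]
    refine ⟨⟨Finset.sdiff_subset, by omega⟩, ⟨fun x hx => ?_, by omega⟩⟩
    exact Finset.mem_compl.2 (Finset.mem_sdiff.1 hx).2
  · intro J _ K _ h
    simp only [Prod.mk.injEq, Finset.ext_iff, Finset.mem_sdiff] at h
    ext x
    have hx1 := h.1 x
    have hx2 := h.2 x
    tauto

/-- A quadratic form is positive when the total weight `w` bounding each row of the off-diagonal
part is dominated by the diagonal. -/
theorem sum_mul_mul_pos_of_abs_le {ι : Type*} [Fintype ι] [DecidableEq ι] {B D : ℝ}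
    (M w : ι → ι → ℝ) (hdiag : ∀ i, B < M i i) (hsymm : ∀ i j, w i j = w j i)
    (hw : ∀ i j, 0 ≤ w i j) (hM : ∀ i j, i ≠ j → |M i j| ≤ w i j)
    (hsum : ∀ i, ∑ j, w i j ≤ D) (hD : D ≤ B) (a : ι → ℝ) (ha : a ≠ 0) :
    0 < ∑ i, ∑ j, a i * M i j * a j := by
  have key : ∀ i j, (if i = j then M i i * a i ^ 2 else 0)
      - (w i j * a i ^ 2 + w j i * a j ^ 2) / 2 ≤ a i * M i j * a j := by
    intro i j
    rw [← hsymm i j]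
    split_ifs with h
    · subst h
      nlinarith [mul_nonneg (hw i i) (sq_nonneg (a i))]
    · obtain ⟨hl, hu⟩ := abs_le.1 (hM i j h)
      nlinarith [mul_nonneg (sub_nonneg.2 hu) (sq_nonneg (a i - a j)),
        mul_nonneg (neg_le_iff_add_nonneg.1 hl) (sq_nonneg (a i + a j))]
  have hrow : ∑ i, ∑ j, w i j * a i ^ 2 ≤ ∑ i, B * a i ^ 2 := by
    refine Finset.sum_le_sum fun i _ => ?_
    rw [← Finset.sum_mul]
    exact mul_le_mul_of_nonneg_right ((hsum i).trans hD) (sq_nonneg _)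
  have hdiag_sum : ∑ i, B * a i ^ 2 < ∑ i, M i i * a i ^ 2 := by
    obtain ⟨i, hi⟩ := Function.ne_iff.1 ha
    refine Finset.sum_lt_sum
      (fun j _ => mul_le_mul_of_nonneg_right (hdiag j).le (sq_nonneg _))
      ⟨i, Finset.mem_univ i, mul_lt_mul_of_pos_right (hdiag i) ?_⟩
    exact sq_pos_of_ne_zero hi
  have hle := Finset.sum_le_sum fun i (_ : i ∈ Finset.univ) =>
    Finset.sum_le_sum fun j (_ : j ∈ Finset.univ) => key i j
  have hcomm : ∑ i, ∑ j, w j i * a j ^ 2 = ∑ i, ∑ j, w i j * a i ^ 2 := Finset.sum_comm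
  simp only [Finset.sum_sub_distrib, ← Finset.sum_div, Finset.sum_add_distrib,
    Finset.sum_ite_eq, Finset.mem_univ, if_true, hcomm] at hle
  linarith

/-- the matrix-positivity argument (3.7) concluding Theorem 3.1. -/
theorem statement10 (n p : ℕ) (hn : 4 ≤ n) (hp2 : 2 ≤ p) (hpn : p ≤ n - 2)
    (A B : ℝ) (hBA : B ≤ A) (hBD : Dconst n p * (A - B) ≤ B)
    (M : {I : Finset (Fin n) // I.card = p} → {I : Finset (Fin n) // I.card = p} → ℝ)
    (hdiag : ∀ I, B < M I I)
    (h1 : ∀ I J : {I : Finset (Fin n) // I.card = p},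
      ((I : Finset (Fin n)) ∩ (J : Finset (Fin n))).card + 1 = p →
      |M I J| ≤ (A - B) / 2)
    (h2 : ∀ I J : {I : Finset (Fin n) // I.card = p},
      ((I : Finset (Fin n)) ∩ (J : Finset (Fin n))).card + 2 = p →
      |M I J| ≤ 4 / 3 * (A - B))
    (h3 : ∀ I J : {I : Finset (Fin n) // I.card = p},
      ((I : Finset (Fin n)) ∩ (J : Finset (Fin n))).card + 3 ≤ p →
      M I J = 0)
    (a : {I : Finset (Fin n) // I.card = p} → ℝ) (ha : a ≠ 0) :
    0 < ∑ I : {I : Finset (Fin n) // I.card = p},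
          ∑ J : {I : Finset (Fin n) // I.card = p}, a I * M I J * a J := by
  have hAB : 0 ≤ A - B := sub_nonneg.2 hBA
  let w : {I : Finset (Fin n) // I.card = p} → {I : Finset (Fin n) // I.card = p} → ℝ :=
    fun I J =>
      (if ((I : Finset (Fin n)) ∩ (J : Finset (Fin n))).card + 1 = p then (A - B) / 2 else 0)
      + (if ((I : Finset (Fin n)) ∩ (J : Finset (Fin n))).card + 2 = p then 4 / 3 * (A - B) else 0)
  refine sum_mul_mul_pos_of_abs_le (D := Dconst n p * (A - B)) M w hdiag ?_ ?_ ?_ ?_ hBD a ha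
  · intro I J
    simp only [w, Finset.inter_comm]
  · intro I J
    simp only [w]
    split_ifs <;> positivity
  · intro I J hIJ
    have hlt : ((I : Finset (Fin n)) ∩ (J : Finset (Fin n))).card < p := by
      by_contra! hge
      have hI := Finset.eq_of_subset_of_card_le
        (Finset.inter_subset_left (s₁ := (I : Finset (Fin n))) (s₂ := J)) (I.2.trans_le hge)
      have hJ := Finset.eq_of_subset_of_card_le
        (Finset.inter_subset_right (s₁ := (I : Finset (Fin n))) (s₂ := J)) (J.2.trans_le hge)
      exact hIJ (Subtype.ext (hI.symm.trans hJ))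
    simp only [w]
    split_ifs with hk1 hk2 hk2
    · omega
    · simpa using h1 I J hk1
    · simpa using h2 I J hk2
    · simp [h3 I J (by omega)]
  · intro I
    have hc1 : ((Finset.univ.filter fun J : {I : Finset (Fin n) // I.card = p} =>
        ((I : Finset (Fin n)) ∩ (J : Finset (Fin n))).card + 1 = p).card : ℝ) ≤
        ((p * (n - p) : ℕ) : ℝ) := by
      exact_mod_cast (card_filter_inter_add_eq_le 1 I).trans_eq (by simp)
    have hc2 : ((Finset.univ.filter fun J : {I : Finset (Fin n) // I.card = p} =>
        ((I : Finset (Fin n)) ∩ (J : Finset (Fin n))).card + 2 = p).card : ℝ) ≤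
        ((p.choose 2 * (n - p).choose 2 : ℕ) : ℝ) := by
      exact_mod_cast card_filter_inter_add_eq_le 2 I
    simp only [w, Finset.sum_add_distrib, ← Finset.sum_filter, Finset.sum_const, nsmul_eq_mul,
      Dconst]
    have hm1 := mul_le_mul_of_nonneg_right hc1 hAB
    have hm2 := mul_le_mul_of_nonneg_right hc2 hAB
    linarith

end
end
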